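/- arXiv:1601.04370 — 2 statements merged into one kernel-verified Lean document; each statement's English description precedes it below -/
import Mathlib

section
/- For the set J associated with d = 5 and v = (1,−1,−1,−1,1), the following congruences hold modulo 2 for every n ≥ 1: X_{5n} ≡ X_n; Y_{5n} ≡ Y_n; X_{5n+1} ≡ Z_{n+1}Y_n; Y_{5n+1} ≡ Z_{n+1}(X_n + Y_n); X_{5n+2} ≡ Z_{n+1}(X_n + Y_n); Y_{5n+2} ≡ Z_{n+1}X_n; X_{5n+3} ≡ Z_{n+1}(X_{n+1} + Y_{n+1}); Y_{5n+3} ≡ Z_{n+1}X_{n+1}; X_{5n+4} ≡ Z_{n+1}Y_{n+1}; Y_{5n+4} ≡ Z_{n+1}(X_{n+1} + Y_{n+1}); Z_{5n} ≡ Z_n(X_n + X_nY_n + Y_n); Z_{5n+1} ≡ Z_{n+1}(X_n + X_nY_n + Y_n); Z_{5n+2} ≡ Z_{n+1}(X_n + X_nY_n + Y_n); Z_{5n+3} ≡ Z_{n+1}; Z_{5n+4} ≡ Z_{n+1}(X_{n+1} + X_{n+1}Y_{n+1} + Y_{n+1}). -/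
/-- `J` for `d = 5`, `v = (1,−1,−1,−1,1)`:
`{(5n+1)·5^k − 1} ∪ {(5n+4)·5^k − 1}`. -/
def J5 : Set ℕ :=
  {t | ∃ n k : ℕ, t + 1 = (5 * n + 1) * 5 ^ k} ∪
  {t | ∃ n k : ℕ, t + 1 = (5 * n + 4) * 5 ^ k}

/-- The number of permutations `σ` of `{0,…,m−1}` with `i + σ(i) ∈ S` for all
`i ≠ l`. -/
noncomputable def permCount (S : Set ℕ) (m l : ℕ) : ℕ :=
  Nat.card {σ : Equiv.Perm (Fin m) //
    ∀ i : Fin m, (i : ℕ) ≠ l → ((i : ℕ) + ((σ i : Fin m) : ℕ)) ∈ S}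

noncomputable def X (n : ℕ) : ℕ := ∑ i ∈ Finset.range n, permCount J5 n i
noncomputable def Y (n : ℕ) : ℕ := permCount J5 n n
noncomputable def Z (n : ℕ) : ℕ := permCount J5 n (n - 1)

/-- The indicator sequence of `J5` modulo 2. -/
noncomputable def jInd (t : ℕ) : ZMod 2 :=
  open Classical in if t ∈ J5 then 1 else 0

theorem jInd_of_mod {t : ℕ} (h : t % 5 = 0 ∨ t % 5 = 3) : jInd t = 1 := by
  rw [jInd, if_pos]
  rcases h with h | h
  · exact Or.inl ⟨t / 5, 0, by omega⟩
  · exact Or.inr ⟨t / 5, 0, by omega⟩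

theorem jInd_of_mod_eq_zero {t : ℕ} (h : t % 5 = 1 ∨ t % 5 = 2) : jInd t = 0 := by
  rw [jInd, if_neg]
  rintro (⟨n, k, hk⟩ | ⟨n, k, hk⟩) <;> cases k with
  | zero => omega
  | succ k =>
    rw [pow_succ, ← mul_assoc] at hk
    omega

theorem jInd_five_mul_add_four (m : ℕ) : jInd (5 * m + 4) = jInd m := by
  have h : 5 * m + 4 ∈ J5 ↔ m ∈ J5 := by
    constructor
    · rintro (⟨n, k, hk⟩ | ⟨n, k, hk⟩) <;> cases k with
      | zero => omega
      | succ k =>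
        rw [pow_succ, ← mul_assoc] at hk
        first
        | exact Or.inl ⟨n, k, by omega⟩
        | exact Or.inr ⟨n, k, by omega⟩
    · rintro (⟨n, k, hk⟩ | ⟨n, k, hk⟩)
      · exact Or.inl ⟨n, k + 1, by rw [pow_succ, ← mul_assoc, ← hk]; ring⟩
      · exact Or.inr ⟨n, k + 1, by rw [pow_succ, ← mul_assoc, ← hk]; ring⟩
  classical simp only [jInd, h]

/-- The determinant of the leading `n × n` block of an infinite matrix over `ZMod 2`. -/
def leadDet (f : ℕ → ℕ → ZMod 2) (n : ℕ) : ZMod 2 :=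
  (Matrix.of fun i j : Fin n => f i j).det

theorem leadDet_transpose (f : ℕ → ℕ → ZMod 2) (n : ℕ) :
    leadDet (fun i j => f j i) n = leadDet f n :=
  Matrix.det_transpose (Matrix.of fun i j : Fin n => f i j)

theorem leadDet_eq_zero_iff {f : ℕ → ℕ → ZMod 2} {n : ℕ} :
    leadDet f n = 0 ↔ ∃ w : ℕ → ZMod 2, (∃ j < n, w j ≠ 0) ∧
      ∀ i < n, ∑ j ∈ Finset.range n, f i j * w j = 0 := by
  rw [leadDet, ← Matrix.exists_mulVec_eq_zero_iff]
  constructor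
  · rintro ⟨v, hv, h⟩
    obtain ⟨j, hj⟩ := Function.ne_iff.1 hv
    refine ⟨fun j => if h : j < n then v ⟨j, h⟩ else 0, ⟨j, j.2, by simpa using hj⟩, ?_⟩
    intro i hi
    rw [Finset.sum_range]
    simpa [Matrix.mulVec, dotProduct] using congrFun h ⟨i, hi⟩
  · rintro ⟨w, ⟨j, hj, hw⟩, h⟩
    refine ⟨fun j => w j, fun h0 => hw (congrFun h0 ⟨j, hj⟩), ?_⟩
    ext i
    have := h i i.2
    rw [Finset.sum_range] at this
    simpa [Matrix.mulVec, dotProduct] using this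

theorem exists_solution_of_leadDet_ne_zero {f : ℕ → ℕ → ZMod 2} {n : ℕ}
    (hf : leadDet f n ≠ 0) (b : ℕ → ZMod 2) :
    ∃ w : ℕ → ZMod 2, ∀ i < n, ∑ j ∈ Finset.range n, f i j * w j = b i := by
  have hu : IsUnit (Matrix.of fun i j : Fin n => f i j) :=
    (Matrix.isUnit_iff_isUnit_det _).2 (isUnit_iff_ne_zero.2 hf)
  obtain ⟨v, hv⟩ := Matrix.mulVec_surjective_iff_isUnit.2 hu (fun i => b i)
  refine ⟨fun j => if h : j < n then v ⟨j, h⟩ else 0, fun i hi => ?_⟩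
  rw [Finset.sum_range]
  simpa [Matrix.mulVec, dotProduct] using congrFun hv ⟨i, hi⟩

theorem leadDet_add_row_indicator (f : ℕ → ℕ → ZMod 2) (n k : ℕ) (hk : k ≤ n) :
    leadDet (fun i j => f i j + if i < k then 1 else 0) n =
      leadDet f n + ∑ l ∈ Finset.range k, leadDet (fun i j => if i = l then 1 else f i j) n := by
  induction k with
  | zero => simp
  | succ k ih =>
    rw [Finset.sum_range_succ, ← add_assoc, ← ih (by omega)]
    let M : Matrix (Fin n) (Fin n) (ZMod 2) :=
      Matrix.of fun i j => f i j + if (i : ℕ) < k then 1 else 0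
    have h1 : (Matrix.of fun i j : Fin n => f i j + if (i : ℕ) < k + 1 then 1 else 0) =
        M.updateRow ⟨k, hk⟩ (M ⟨k, hk⟩ + fun _ => 1) := by
      ext i j
      by_cases h : i = ⟨k, hk⟩
      · subst h; simp [M]
      · have h' : (i : ℕ) ≠ k := fun e => h (Fin.ext e)
        have h'' : (i : ℕ) ≤ k ↔ (i : ℕ) < k := by omega
        simp [M, h, h'']
    have h2 : (M.updateRow ⟨k, hk⟩ fun _ => 1).det =
        (Matrix.of fun i j : Fin n => if (i : ℕ) = k then 1 else f i j).det := by
      refine Matrix.det_eq_of_forall_row_eq_smul_add_const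
        (fun i => if (i : ℕ) < k then 1 else 0) ⟨k, hk⟩ (by simp) fun i j => ?_
      by_cases h : i = ⟨k, hk⟩
      · subst h; simp
      · have h' : (i : ℕ) ≠ k := fun e => h (Fin.ext e)
        simp [M, h, h']
    rw [leadDet, h1, Matrix.det_updateRow_add, Matrix.updateRow_eq_self, h2]
    rfl

theorem natCast_permCount (m l : ℕ) :
    (permCount J5 m l : ZMod 2) = leadDet (fun i j => if i = l then 1 else jInd (i + j)) m := by
  classical
  rw [permCount, Nat.card_eq_fintype_card, Fintype.card_subtype, Finset.card_filter, Nat.cast_sum,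
    leadDet, ← Matrix.det_transpose, Matrix.det_apply]
  refine Finset.sum_congr rfl fun σ _ => ?_
  have hs : ((Equiv.Perm.sign σ : ℤˣ) : ℤ) • (1 : ZMod 2) = 1 := by
    rcases Int.units_eq_one_or (Equiv.Perm.sign σ) with h | h <;> rw [h] <;> decide
  have hs' : ∀ x : ZMod 2, Equiv.Perm.sign σ • x = x := fun x => by
    rw [Units.smul_def, ← mul_one x, ← mul_smul_comm, hs]
  rw [hs']
  split_ifs with h
  · rw [Nat.cast_one, Finset.prod_eq_one]
    intro i _
    by_cases hi : (i : ℕ) = l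
    · simp [hi]
    · simp [hi, jInd, h i hi]
  · push Not at h
    obtain ⟨i, hi, hJ⟩ := h
    rw [Nat.cast_zero, eq_comm]
    exact Finset.prod_eq_zero (Finset.mem_univ i) (by simp [hi, jInd, hJ])

/-- The determinant modulo 2 of the Hankel matrix of `J5` shifted by a constant matrix. -/
noncomputable def hankelDet (δ : ZMod 2) (n : ℕ) : ZMod 2 :=
  leadDet (fun i j => jInd (i + j) + δ) n

/-- The Hankel determinant of `J5` modulo 2 with its last row replaced by ones. -/
noncomputable def lastRowDet (n : ℕ) : ZMod 2 :=
  leadDet (fun i j => if i = n - 1 then 1 else jInd (i + j)) n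

theorem natCast_Y (n : ℕ) : (Y n : ZMod 2) = hankelDet 0 n := by
  rw [Y, natCast_permCount, hankelDet, leadDet, leadDet]
  congr 1
  ext i j
  simp [i.2.ne]

theorem natCast_Z (n : ℕ) : (Z n : ZMod 2) = lastRowDet n :=
  natCast_permCount n (n - 1)

theorem natCast_X_add_Y (n : ℕ) : (X n : ZMod 2) + Y n = hankelDet 1 n := by
  have h := leadDet_add_row_indicator (fun i j => jInd (i + j)) n n le_rfl
  have h1 : leadDet (fun i j => jInd (i + j) + if i < n then 1 else 0) n = hankelDet 1 n := by
    simp [hankelDet, leadDet]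
  have h0 : leadDet (fun i j => jInd (i + j)) n = hankelDet 0 n := by simp [hankelDet]
  rw [h1, h0] at h
  rw [h, natCast_Y, X, Nat.cast_sum, add_comm]
  simp only [natCast_permCount]

theorem hankelDet_eq (δ : ZMod 2) (n : ℕ) : hankelDet δ n = Y n + δ * X n := by
  have h : δ = 0 ∨ δ = 1 := by revert δ; decide
  rcases h with rfl | rfl
  · rw [natCast_Y]; ring
  · rw [← natCast_X_add_Y]; ring

/-- `w` is mapped by the `k × l` Hankel block to the constant vector `c`, and has sum `s`. -/
def IsSol (k l : ℕ) (w : ℕ → ZMod 2) (s c : ZMod 2) : Prop :=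
  (∀ i < k, ∑ j ∈ Finset.range l, jInd (i + j) * w j = c) ∧ ∑ j ∈ Finset.range l, w j = s

/-- The pairs (sum, constant) realised by the `k × l` Hankel block. -/
def SolPair (k l : ℕ) (s c : ZMod 2) : Prop := ∃ w, IsSol k l w s c

/-- No nonzero vector of sum zero is killed by the `k × l` Hankel block. -/
def TrivialKer (k l : ℕ) : Prop := ∀ w, IsSol k l w 0 0 → ∀ j < l, w j = 0

theorem IsSol.add {k l : ℕ} {v w : ℕ → ZMod 2} {s c s' c' : ZMod 2}
    (hv : IsSol k l v s c) (hw : IsSol k l w s' c') :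
    IsSol k l (fun j => v j + w j) (s + s') (c + c') :=
  ⟨fun i hi => by simp only [mul_add, Finset.sum_add_distrib, hv.1 i hi, hw.1 i hi],
    by rw [Finset.sum_add_distrib, hv.2, hw.2]⟩

theorem hankelDet_eq_zero_iff {δ : ZMod 2} {n : ℕ} :
    hankelDet δ n = 0 ↔ ∃ w s, (∃ j < n, w j ≠ 0) ∧ IsSol n n w s (δ * s) := by
  rw [hankelDet, leadDet_eq_zero_iff]
  have key (w : ℕ → ZMod 2) (i : ℕ) :
      ∑ j ∈ Finset.range n, (jInd (i + j) + δ) * w j = 0 ↔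
      ∑ j ∈ Finset.range n, jInd (i + j) * w j = δ * ∑ j ∈ Finset.range n, w j := by
    simp only [add_mul, Finset.sum_add_distrib, ← Finset.mul_sum]
    rw [CharTwo.add_eq_zero]
  simp only [key]
  constructor
  · rintro ⟨w, hw, h⟩
    exact ⟨w, _, hw, h, rfl⟩
  · rintro ⟨w, s, hw, h, rfl⟩
    exact ⟨w, hw, h⟩

theorem IsSol.pairing {k l : ℕ} {v w : ℕ → ZMod 2} {s c s' c' : ZMod 2}
    (hv : IsSol k l v s c) (hw : IsSol l k w s' c') : c * s' = c' * s := by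
  calc c * s' = ∑ i ∈ Finset.range k, ∑ j ∈ Finset.range l, jInd (i + j) * v j * w i := by
        rw [← hw.2, Finset.mul_sum]
        refine Finset.sum_congr rfl fun i hi => ?_
        rw [← Finset.sum_mul, hv.1 i (Finset.mem_range.1 hi)]
    _ = ∑ j ∈ Finset.range l, ∑ i ∈ Finset.range k, jInd (i + j) * v j * w i := Finset.sum_comm
    _ = c' * s := by
        rw [← hv.2, Finset.mul_sum]
        refine Finset.sum_congr rfl fun j hj => ?_
        rw [← hw.1 j (Finset.mem_range.1 hj), Finset.sum_mul]
        refine Finset.sum_congr rfl fun i _ => ?_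
        rw [add_comm i j]; ring

theorem zmod_two_cases (x : ZMod 2) : x = 0 ∨ x = 1 := by
  revert x; decide

theorem not_trivialKer_of_zero {n : ℕ} (h0 : hankelDet 0 n = 0) (h1 : hankelDet 1 n = 0) :
    ¬ TrivialKer n n := by
  intro hK
  obtain ⟨w, s, ⟨j, hj, hwj⟩, hw⟩ := hankelDet_eq_zero_iff.1 h0
  obtain ⟨v, t, ⟨i, hi, hvi⟩, hv⟩ := hankelDet_eq_zero_iff.1 h1
  rw [zero_mul] at hw
  rw [one_mul] at hv
  have hp := hv.pairing hw
  rcases zmod_two_cases s with rfl | rfl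
  · exact hwj (hK w hw j hj)
  · rw [mul_one, zero_mul] at hp
    subst hp
    exact hvi (hK v hv i hi)

theorem trivialKer_of_ne_zero {n : ℕ} {δ : ZMod 2} (h : hankelDet δ n ≠ 0) :
    TrivialKer n n := by
  intro w hw j hj
  by_contra hne
  exact h (hankelDet_eq_zero_iff.2 ⟨w, 0, ⟨j, hj, hne⟩, by rwa [mul_zero]⟩)

theorem solPair_self_iff {n : ℕ} (hK : TrivialKer n n) {s c : ZMod 2} :
    SolPair n n s c ↔ (Y n : ZMod 2) * s = X n * c := by
  have hX : (X n : ZMod 2) = hankelDet 1 n + hankelDet 0 n := by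
    rw [← natCast_X_add_Y, ← natCast_Y, add_assoc, CharTwo.add_self_eq_zero, add_zero]
  have hzero : SolPair n n 0 0 := ⟨fun _ => 0, by simp [IsSol]⟩
  have huniq (s c s' c' : ZMod 2) (h : SolPair n n s c) (h' : SolPair n n s' c') :
      c * s' = c' * s := by
    obtain ⟨w, hw⟩ := h
    obtain ⟨w', hw'⟩ := h'
    exact hw.pairing hw'
  rw [natCast_Y, hX]
  have hex : SolPair n n (hankelDet 1 n + hankelDet 0 n) (hankelDet 0 n) := by
    rcases zmod_two_cases (hankelDet 0 n) with h0 | h0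
    · obtain ⟨w, s, ⟨j, hj, hwj⟩, hw⟩ := hankelDet_eq_zero_iff.1 h0
      rw [zero_mul] at hw
      have hs : s = 1 := (zmod_two_cases s).resolve_left fun e => hwj (hK w (e ▸ hw) j hj)
      have h1 : hankelDet 1 n = 1 :=
        (zmod_two_cases _).resolve_left fun e => not_trivialKer_of_zero h0 e hK
      rw [h0, h1, add_zero, ← hs]
      exact ⟨w, hw⟩
    · rcases zmod_two_cases (hankelDet 1 n) with h1 | h1
      · obtain ⟨w, s, ⟨j, hj, hwj⟩, hw⟩ := hankelDet_eq_zero_iff.1 h1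
        rw [one_mul] at hw
        have hs : s = 1 := (zmod_two_cases s).resolve_left fun e =>
          hwj (hK w (by rwa [e] at hw) j hj)
        rw [h0, h1, zero_add]
        exact ⟨w, hs ▸ hw⟩
      · have h0' : leadDet (fun i j => jInd (i + j) + 0) n ≠ 0 := by
          rw [← hankelDet, h0]; exact one_ne_zero
        obtain ⟨w, hw⟩ := exists_solution_of_leadDet_ne_zero h0' fun _ => 1
        simp only [add_zero] at hw
        rcases zmod_two_cases (∑ j ∈ Finset.range n, w j) with hs | hs
        · rw [h0, h1, CharTwo.add_self_eq_zero]
          exact ⟨w, hw, hs⟩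
        · exfalso
          have hne : ∃ j < n, w j ≠ 0 := by
            by_contra! hall
            rw [Finset.sum_eq_zero fun j hj => hall j (Finset.mem_range.1 hj)] at hs
            exact zero_ne_one hs
          have : hankelDet 1 n = 0 := hankelDet_eq_zero_iff.2 ⟨w, 1, hne, hw, hs⟩
          exact zero_ne_one (this.symm.trans h1)
  have hne : ¬ (hankelDet 0 n = 0 ∧ hankelDet 1 n = 0) :=
    fun h => not_trivialKer_of_zero h.1 h.2 hK
  constructor
  · intro h
    rw [huniq _ _ _ _ hex h, mul_comm]
  · intro h
    generalize hankelDet 0 n = y at *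
    generalize hankelDet 1 n = z at *
    have : (s = 0 ∧ c = 0) ∨ (s = z + y ∧ c = y) := by
      clear hex huniq hzero hX hK
      revert s c y z
      decide
    rcases this with ⟨rfl, rfl⟩ | ⟨rfl, rfl⟩
    · exact hzero
    · exact hex

theorem lastRowDet_eq_zero_iff {n : ℕ} : lastRowDet (n + 1) = 0 ↔ ¬ TrivialKer n (n + 1) := by
  rw [lastRowDet, leadDet_eq_zero_iff, TrivialKer]
  push Not
  constructor
  · rintro ⟨w, hw, h⟩
    refine ⟨w, ⟨fun i hi => ?_, ?_⟩, hw⟩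
    · simpa [hi.ne] using h i (by omega)
    · simpa using h n (by omega)
  · rintro ⟨w, h, hw⟩
    refine ⟨w, hw, fun i hi => ?_⟩
    rcases Nat.lt_succ_iff_lt_or_eq.1 hi with hi' | rfl
    · simpa [hi'.ne] using h.1 i hi'
    · simpa using h.2

theorem solPair_of_lastRowDet_ne_zero {n : ℕ} (h : lastRowDet (n + 1) ≠ 0) (s c : ZMod 2) :
    SolPair n (n + 1) s c := by
  obtain ⟨w, hw⟩ := exists_solution_of_leadDet_ne_zero h fun i => if i = n then s else c
  refine ⟨w, fun i hi => ?_, ?_⟩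
  · simpa [hi.ne] using hw i (by omega)
  · simpa using hw n (by omega)

theorem lastRowDet_eq_zero_iff_transpose {n : ℕ} :
    lastRowDet (n + 1) = 0 ↔
      ∃ w s c, ((∃ j < n, w j ≠ 0) ∨ c ≠ 0) ∧ IsSol (n + 1) n w s c := by
  have key (w : ℕ → ZMod 2) (i : ℕ) : (∑ j ∈ Finset.range (n + 1),
      (if j = n + 1 - 1 then 1 else jInd (j + i)) * w j = 0) ↔
      ∑ j ∈ Finset.range n, jInd (i + j) * w j = w n := by
    rw [Finset.sum_range_succ, CharTwo.add_eq_zero]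
    refine Eq.congr (Finset.sum_congr rfl fun j hj => ?_) (by simp)
    simp [(Finset.mem_range.1 hj).ne, add_comm]
  rw [lastRowDet, ← leadDet_transpose, leadDet_eq_zero_iff]
  simp only [key]
  constructor
  · rintro ⟨w, ⟨j, hj, hwj⟩, h⟩
    refine ⟨w, _, w n, ?_, h, rfl⟩
    rcases Nat.lt_succ_iff_lt_or_eq.1 hj with hj' | rfl
    · exact Or.inl ⟨j, hj', hwj⟩
    · exact Or.inr hwj
  · rintro ⟨w, s, c, hne, h, -⟩
    refine ⟨Function.update w n c, ?_, fun i hi => ?_⟩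
    · rcases hne with ⟨j, hj, hwj⟩ | hc
      · exact ⟨j, by omega, by rwa [Function.update_of_ne hj.ne]⟩
      · exact ⟨n, by omega, by rwa [Function.update_self]⟩
    · rw [Function.update_self, ← h i hi]
      refine Finset.sum_congr rfl fun j hj => ?_
      rw [Function.update_of_ne (Finset.mem_range.1 hj).ne]

theorem trivialKer_succ_left {n : ℕ} (h : lastRowDet (n + 1) ≠ 0) : TrivialKer (n + 1) n := by
  intro w hw j hj
  by_contra hne
  exact h (lastRowDet_eq_zero_iff_transpose.2 ⟨w, 0, 0, Or.inl ⟨j, hj, hne⟩, hw⟩)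

theorem solPair_succ_left_iff {n : ℕ} (h : lastRowDet (n + 1) ≠ 0) {s c : ZMod 2} :
    SolPair (n + 1) n s c ↔ s = 0 ∧ c = 0 := by
  constructor
  · rintro ⟨w, hw⟩
    have hc : c = 0 := by
      by_contra hc
      exact h (lastRowDet_eq_zero_iff_transpose.2 ⟨w, s, c, Or.inr hc, hw⟩)
    refine ⟨?_, hc⟩
    rw [← hw.2]
    refine Finset.sum_eq_zero fun j hj => ?_
    by_contra hne
    exact h (lastRowDet_eq_zero_iff_transpose.2
      ⟨w, s, c, Or.inl ⟨j, Finset.mem_range.1 hj, hne⟩, hw⟩)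
  · rintro ⟨rfl, rfl⟩
    exact ⟨fun _ => 0, by simp [IsSol]⟩

theorem IsSol.extend {k n : ℕ} {w : ℕ → ZMod 2} {s c : ZMod 2} (h : IsSol k n w s c) :
    IsSol k (n + 1) (Function.update w n 0) s c := by
  have hu (j) (hj : j ∈ Finset.range n) : Function.update w n 0 j = w j :=
    Function.update_of_ne (Finset.mem_range.1 hj).ne _ _
  refine ⟨fun i hi => ?_, ?_⟩
  · rw [Finset.sum_range_succ, Function.update_self, mul_zero, add_zero, ← h.1 i hi]
    exact Finset.sum_congr rfl fun j hj => by rw [hu j hj]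
  · rw [Finset.sum_range_succ, Function.update_self, add_zero, ← h.2]
    exact Finset.sum_congr rfl hu

theorem IsSol.mono {k k' l : ℕ} (hk : k ≤ k') {w : ℕ → ZMod 2} {s c : ZMod 2}
    (h : IsSol k' l w s c) : IsSol k l w s c :=
  ⟨fun i hi => h.1 i (by omega), h.2⟩

theorem trivialKer_self_of_lastRowDet {n : ℕ} (h : lastRowDet (n + 1) ≠ 0) : TrivialKer n n := by
  have hT := not_not.1 fun e => h (lastRowDet_eq_zero_iff.2 e)
  intro w hw j hj
  have := hT _ hw.extend j (by omega)
  rwa [Function.update_of_ne hj.ne] at this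

theorem trivialKer_succ_succ_of_lastRowDet {n : ℕ} (h : lastRowDet (n + 1) ≠ 0) :
    TrivialKer (n + 1) (n + 1) := by
  have hT := not_not.1 fun e => h (lastRowDet_eq_zero_iff.2 e)
  exact fun w hw => hT w (hw.mono n.le_succ)

theorem trivialKer_self_iff {n : ℕ} :
    TrivialKer n n ↔ ¬ ((X n : ZMod 2) = 0 ∧ (Y n : ZMod 2) = 0) := by
  constructor
  · rintro hK ⟨hX, hY⟩
    refine not_trivialKer_of_zero ?_ ?_ hK <;> simp [hankelDet_eq, hX, hY]
  · intro h
    by_cases hY : (Y n : ZMod 2) = 0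
    · refine trivialKer_of_ne_zero (δ := 1) ?_
      rw [hankelDet_eq, hY, zero_add, one_mul]
      exact fun e => h ⟨e, hY⟩
    · refine trivialKer_of_ne_zero (δ := 0) ?_
      rwa [hankelDet_eq, zero_mul, add_zero]

/-- The Desnanot–Jacobi identity for the bordered Hankel matrix, modulo 2. -/
theorem natCast_Z_succ (n : ℕ) :
    (Z (n + 1) : ZMod 2) = X (n + 1) * Y n + X n * Y (n + 1) := by
  rw [natCast_Z]
  by_cases h : lastRowDet (n + 1) = 0
  · rw [h]
    obtain ⟨w, s, c, hne, hw⟩ := lastRowDet_eq_zero_iff_transpose.1 h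
    by_cases hK : TrivialKer n n
    · by_cases hK' : TrivialKer (n + 1) (n + 1)
      · have h1 := (solPair_self_iff hK).1 ⟨w, hw.mono n.le_succ⟩
        have h2 := (solPair_self_iff hK').1 ⟨_, hw.extend⟩
        have h3 : ¬ (s = 0 ∧ c = 0) := by
          rintro ⟨rfl, rfl⟩
          rcases hne with ⟨j, hj, hwj⟩ | hc
          · exact hwj (hK w (hw.mono n.le_succ) j hj)
          · exact hc rfl
        clear hw hne hK hK' h
        generalize (X n : ZMod 2) = x at *
        generalize (Y n : ZMod 2) = y at *
        generalize (X (n + 1) : ZMod 2) = x' at *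
        generalize (Y (n + 1) : ZMod 2) = y' at *
        revert x y x' y' s c
        decide
      · rw [trivialKer_self_iff, not_not] at hK'
        rw [hK'.1, hK'.2]; ring
    · rw [trivialKer_self_iff, not_not] at hK
      rw [hK.1, hK.2]; ring
  · have hK := trivialKer_self_of_lastRowDet h
    have hK' := trivialKer_succ_succ_of_lastRowDet h
    have hT := not_not.1 fun e => h (lastRowDet_eq_zero_iff.2 e)
    have hdisj (s c : ZMod 2) (h1 : (Y n : ZMod 2) * s = X n * c)
        (h2 : (Y (n + 1) : ZMod 2) * s = X (n + 1) * c) : s = 0 ∧ c = 0 := by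
      obtain ⟨v, hv⟩ := (solPair_self_iff hK).2 h1
      obtain ⟨w, hw⟩ := (solPair_self_iff hK').2 h2
      have hsum := hv.extend.add (hw.mono n.le_succ)
      simp only [CharTwo.add_self_eq_zero] at hsum
      have heq (j) (hj : j < n + 1) : Function.update v n 0 j = w j :=
        CharTwo.add_eq_zero.1 (hT _ hsum j hj)
      refine (solPair_succ_left_iff h).1 ⟨v, fun i hi => ?_, hv.2⟩
      have := hw.1 i hi
      rw [Finset.sum_range_succ, ← heq n (by omega), Function.update_self, mul_zero,
        add_zero] at this
      rw [← this]
      refine Finset.sum_congr rfl fun j hj => ?_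
      have hj := Finset.mem_range.1 hj
      rw [← heq j (by omega), Function.update_of_ne hj.ne]
    rw [trivialKer_self_iff] at hK hK'
    rw [(zmod_two_cases _).resolve_left h]
    clear hT h
    generalize (X n : ZMod 2) = x at *
    generalize (Y n : ZMod 2) = y at *
    generalize (X (n + 1) : ZMod 2) = x' at *
    generalize (Y (n + 1) : ZMod 2) = y' at *
    revert x y x' y'
    decide

/-- The constant value of the Hankel entries whose index classes modulo 5 are `r` and `s`, when
`r + s ≠ 4`. -/
def classEntry (r s : Fin 5) : ZMod 2 :=
  if (r + s : ℕ) % 5 = 0 ∨ (r + s : ℕ) % 5 = 3 then 1 else 0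

/-- The constant vector that the block of column class `r` must produce, given the sums `s` of all
column classes. -/
def coupling (δ : ZMod 2) (s : Fin 5 → ZMod 2) (r : Fin 5) : ZMod 2 :=
  ∑ r' : Fin 5, (classEntry r.rev r' + δ) * s r'

theorem jInd_class (r s : Fin 5) (p q : ℕ) :
    jInd (5 * p + r + (5 * q + s)) =
      (if s = r.rev then jInd (p + q) else 0) + classEntry r s := by
  by_cases h : s = r.rev
  · have hv : (s : ℕ) = 4 - r := by rw [h, Fin.val_rev]; omega
    have hr := r.2
    have e : 5 * p + (r : ℕ) + (5 * q + s) = 5 * (p + q) + 4 := by omega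
    have h4 : (r + s : ℕ) % 5 = 4 := by omega
    rw [e, jInd_five_mul_add_four, if_pos h, classEntry, if_neg (by omega), add_zero]
  · have hv : (r + s : ℕ) % 5 ≠ 4 := by
      intro e
      apply h
      ext
      rw [Fin.val_rev]
      omega
    rw [if_neg h, zero_add, classEntry]
    split_ifs with h0
    · exact jInd_of_mod (by omega)
    · exact jInd_of_mod_eq_zero (by omega)

theorem sum_range_eq_sum_classes {N : ℕ} {m : Fin 5 → ℕ}
    (hm : ∀ r p, p < m r ↔ 5 * p + (r : ℕ) < N) (g : ℕ → ZMod 2) :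
    ∑ j ∈ Finset.range N, g j = ∑ r : Fin 5, ∑ q ∈ Finset.range (m r), g (5 * q + r) := by
  rw [Finset.sum_sigma']
  refine Finset.sum_nbij' (fun j => ⟨⟨j % 5, by omega⟩, j / 5⟩) (fun x => 5 * x.2 + x.1)
    ?_ ?_ ?_ ?_ ?_
  · intro j hj
    have := Finset.mem_range.1 hj
    simp only [Finset.mem_sigma, Finset.mem_univ, true_and, Finset.mem_range, hm]
    omega
  · rintro ⟨r, q⟩ hx
    simpa [hm] using hx
  · intro j _
    dsimp only
    omega
  · rintro ⟨r, q⟩ _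
    have hr := r.2
    have h1 : (5 * q + (r : ℕ)) % 5 = r := by omega
    have h2 : (5 * q + (r : ℕ)) / 5 = q := by omega
    simp only [h1, h2]
  · intro j _
    dsimp only
    congr 1
    omega

theorem hankelDet_eq_zero_iff_classes {N : ℕ} {m : Fin 5 → ℕ}
    (hm : ∀ r p, p < m r ↔ 5 * p + (r : ℕ) < N) (δ : ZMod 2) :
    hankelDet δ N = 0 ↔ ∃ (w : Fin 5 → ℕ → ZMod 2) (s : Fin 5 → ZMod 2),
      (∃ r, ∃ j < m r, w r j ≠ 0) ∧
      ∀ r, IsSol (m r.rev) (m r) (w r) (s r) (coupling δ s r) := by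
  have key (w : ℕ → ZMod 2) (r : Fin 5) (p : ℕ) :
      ∑ j ∈ Finset.range N, (jInd (5 * p + r + j) + δ) * w j = 0 ↔
      ∑ q ∈ Finset.range (m r.rev), jInd (p + q) * w (5 * q + r.rev) =
        coupling δ (fun r' => ∑ q ∈ Finset.range (m r'), w (5 * q + r')) r.rev := by
    refine Iff.trans (Eq.congr ?_ rfl) CharTwo.add_eq_zero
    rw [sum_range_eq_sum_classes hm, coupling]
    simp only [jInd_class, add_mul, ite_mul, zero_mul, Finset.sum_add_distrib,
      Finset.mul_sum, Fin.rev_rev, add_assoc (∑ _, ∑ _ ∈ _, ite _ _ _)]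
    refine congrArg₂ _ ?_ rfl
    rw [Finset.sum_eq_single r.rev (fun b _ hb => by simp [hb]) (by simp)]
    simp
  rw [hankelDet, leadDet_eq_zero_iff]
  constructor
  · rintro ⟨w, ⟨j, hj, hwj⟩, h⟩
    refine ⟨fun r q => w (5 * q + r), _, ⟨⟨j % 5, by omega⟩, j / 5, ?_, ?_⟩,
      fun r => ⟨fun p hp => ?_, rfl⟩⟩
    · rw [hm]
      dsimp only
      omega
    · dsimp only
      rwa [show 5 * (j / 5) + j % 5 = j by omega]
    · have := (key w r.rev p).1 (h _ ((hm _ _).1 hp))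
      rwa [Fin.rev_rev] at this
  · rintro ⟨w, s, ⟨r, j, hj, hwj⟩, h⟩
    have hw (r : Fin 5) (q : ℕ) :
        (fun j => w ⟨j % 5, by omega⟩ (j / 5)) (5 * q + r) = w r q := by
      have hr := r.2
      have h1 : (5 * q + (r : ℕ)) % 5 = r := by omega
      have h2 : (5 * q + (r : ℕ)) / 5 = q := by omega
      simp only [h1, h2]
    refine ⟨fun j => w ⟨j % 5, by omega⟩ (j / 5), ⟨5 * j + r, (hm _ _).1 hj, ?_⟩, fun i hi => ?_⟩
    · rw [hw r j]; exact hwj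
    · obtain ⟨r, p, rfl⟩ : ∃ (r : Fin 5) (p : ℕ), i = 5 * p + r :=
        ⟨⟨i % 5, by omega⟩, i / 5, by dsimp only; omega⟩
      rw [key]
      have h1 := (h r.rev).1 p (by rw [Fin.rev_rev]; exact (hm _ _).2 hi)
      have h2 : (fun r' : Fin 5 => ∑ q ∈ Finset.range (m r'),
          (fun j => w ⟨j % 5, by omega⟩ (j / 5)) (5 * q + r')) = s := by
        ext r'
        rw [← (h r').2]
        exact Finset.sum_congr rfl fun q _ => hw r' q
      rw [h2, ← h1]
      exact Finset.sum_congr rfl fun q _ => congrArg _ (hw _ q)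

theorem hankelDet_eq_zero_of_not_trivialKer {N : ℕ} {m : Fin 5 → ℕ}
    (hm : ∀ r p, p < m r ↔ 5 * p + (r : ℕ) < N) (δ : ZMod 2) {r : Fin 5}
    (hr : ¬ TrivialKer (m r.rev) (m r)) : hankelDet δ N = 0 := by
  rw [TrivialKer] at hr
  push Not at hr
  obtain ⟨v, hv, j, hj, hvj⟩ := hr
  refine (hankelDet_eq_zero_iff_classes hm δ).2
    ⟨fun r' => if r' = r then v else fun _ => 0, fun _ => 0, ⟨r, j, hj, by simpa using hvj⟩,
      fun r' => ?_⟩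
  have hc : coupling δ (fun _ => 0) r' = 0 := by simp [coupling]
  rw [hc]
  by_cases h : r' = r
  · subst h
    simpa using hv
  · simp [h, IsSol]

theorem hankelDet_eq_zero_iff_solPair {N : ℕ} {m : Fin 5 → ℕ}
    (hm : ∀ r p, p < m r ↔ 5 * p + (r : ℕ) < N) (δ : ZMod 2)
    (hK : ∀ r : Fin 5, TrivialKer (m r.rev) (m r)) :
    hankelDet δ N = 0 ↔
      ∃ s : Fin 5 → ZMod 2, s ≠ 0 ∧ ∀ r, SolPair (m r.rev) (m r) (s r) (coupling δ s r) := by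
  rw [hankelDet_eq_zero_iff_classes hm]
  constructor
  · rintro ⟨w, s, ⟨r, j, hj, hwj⟩, h⟩
    refine ⟨s, ?_, fun r => ⟨w r, h r⟩⟩
    rintro rfl
    have hr := h r
    have hc : coupling δ 0 r = 0 := by simp [coupling]
    rw [hc] at hr
    exact hwj (hK r _ hr j hj)
  · rintro ⟨s, hs, h⟩
    choose w hw using h
    refine ⟨w, s, ?_, hw⟩
    by_contra! hall
    apply hs
    ext r
    rw [← (hw r).2]
    exact Finset.sum_eq_zero fun j hj => hall r j (Finset.mem_range.1 hj)

/-- The pairs admissible for column class `r` of the Hankel matrix of size `5n + t`, when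
`Z (n + 1)` is odd or `t = 0`; `x, y` are the values of `X, Y` at the size of the square blocks. -/
def Admissible (t : ℕ) (x y : ZMod 2) (r : Fin 5) (s c : ZMod 2) : Prop :=
  if (r : ℕ) < t then
    if (r.rev : ℕ) < t then y * s = x * c else True
  else if (r.rev : ℕ) < t then s = 0 ∧ c = 0 else y * s = x * c

instance (t : ℕ) (x y : ZMod 2) (r : Fin 5) (s c : ZMod 2) : Decidable (Admissible t x y r s c) := by
  unfold Admissible
  infer_instance

theorem classSize_spec (n t : ℕ) (ht : t < 5) (r : Fin 5) (p : ℕ) :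
    p < (if (r : ℕ) < t then n + 1 else n) ↔ 5 * p + (r : ℕ) < 5 * n + t := by
  have := r.2
  split_ifs <;> omega

theorem zmod_two_eq_of_zero_iff {a b : ZMod 2} (h : a = 0 ↔ b = 0) : a = b := by
  revert a b; decide

theorem hankelDet_five_mul (n : ℕ) (δ : ZMod 2) :
    hankelDet δ (5 * n) = Y n + δ * X n := by
  have hm := classSize_spec n 0 (by omega)
  simp only [Nat.not_lt_zero, if_false, add_zero] at hm
  by_cases hK : TrivialKer n n
  · apply zmod_two_eq_of_zero_iff
    rw [hankelDet_eq_zero_iff_solPair (m := fun _ => n) hm δ fun _ => hK]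
    simp only [solPair_self_iff hK]
    rw [trivialKer_self_iff] at hK
    generalize (X n : ZMod 2) = x at *
    generalize (Y n : ZMod 2) = y at *
    revert x y δ
    decide +kernel
  · rw [hankelDet_eq_zero_of_not_trivialKer (m := fun _ => n) hm δ (r := 0) hK]
    rw [trivialKer_self_iff, not_not] at hK
    rw [hK.1, hK.2]; ring

theorem hankelDet_five_mul_add_eq_zero {n t : ℕ} (ht : 1 ≤ t) (ht' : t < 5)
    (hZ : lastRowDet (n + 1) = 0) (δ : ZMod 2) : hankelDet δ (5 * n + t) = 0 := by
  refine hankelDet_eq_zero_of_not_trivialKer (classSize_spec n t ht') δ (r := 0) ?_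
  have h1 : ¬ (4 : ℕ) < t := by omega
  have h2 : 0 < t := by omega
  simpa [Fin.val_rev, h1, h2] using lastRowDet_eq_zero_iff.1 hZ

theorem hankelDet_five_mul_add_eq_zero_iff {n t : ℕ} (ht' : t < 5)
    (hZ : lastRowDet (n + 1) ≠ 0) (δ : ZMod 2) {x y : ZMod 2}
    (hx : x = X (if t < 3 then n else n + 1)) (hy : y = Y (if t < 3 then n else n + 1)) :
    hankelDet δ (5 * n + t) = 0 ↔
      ∃ s : Fin 5 → ZMod 2, s ≠ 0 ∧ ∀ r, Admissible t x y r (s r) (coupling δ s r) := by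
  have hT := not_not.1 fun e => hZ (lastRowDet_eq_zero_iff.2 e)
  have hKn := trivialKer_self_of_lastRowDet hZ
  have hKs := trivialKer_succ_succ_of_lastRowDet hZ
  rw [hankelDet_eq_zero_iff_solPair (classSize_spec n t ht') δ]
  · refine exists_congr fun s => and_congr_right fun _ => forall_congr' fun r => ?_
    have hr := Fin.val_rev r
    have hr5 := r.2
    rw [Admissible]
    split_ifs with h1 h2 h2
    · rw [solPair_self_iff hKs, hx, hy, if_neg (by omega)]
    · exact solPair_succ_left_iff hZ
    · exact iff_true_intro (solPair_of_lastRowDet_ne_zero hZ _ _)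
    · rw [solPair_self_iff hKn, hx, hy, if_pos (by omega)]
  · intro r
    split_ifs
    · exact hKs
    · exact trivialKer_succ_left hZ
    · exact hT
    · exact hKn

theorem hankelDet_five_mul_add (n : ℕ) (δ : ZMod 2) :
    hankelDet δ (5 * n + 1) = Z (n + 1) * (X n + Y n + δ * Y n) ∧
    hankelDet δ (5 * n + 2) = Z (n + 1) * (X n + δ * (X n + Y n)) ∧
    hankelDet δ (5 * n + 3) = Z (n + 1) * (X (n + 1) + δ * (X (n + 1) + Y (n + 1))) ∧
    hankelDet δ (5 * n + 4) = Z (n + 1) * (X (n + 1) + Y (n + 1) + δ * Y (n + 1)) := by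
  rw [natCast_Z]
  by_cases hZ : lastRowDet (n + 1) = 0
  · simp [hZ, hankelDet_five_mul_add_eq_zero]
  · have hKn := trivialKer_self_iff.1 (trivialKer_self_of_lastRowDet hZ)
    have hKs := trivialKer_self_iff.1 (trivialKer_succ_succ_of_lastRowDet hZ)
    have h1 := hankelDet_five_mul_add_eq_zero_iff (t := 1) (by omega) hZ δ rfl rfl
    have h2 := hankelDet_five_mul_add_eq_zero_iff (t := 2) (by omega) hZ δ rfl rfl
    have h3 := hankelDet_five_mul_add_eq_zero_iff (t := 3) (by omega) hZ δ rfl rfl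
    have h4 := hankelDet_five_mul_add_eq_zero_iff (t := 4) (by omega) hZ δ rfl rfl
    simp only [Nat.reduceLT, if_true, if_false] at h1 h2 h3 h4
    rw [(zmod_two_cases _).resolve_left hZ]
    simp only [one_mul]
    refine ⟨zmod_two_eq_of_zero_iff (h1.trans ?_), zmod_two_eq_of_zero_iff (h2.trans ?_),
      zmod_two_eq_of_zero_iff (h3.trans ?_), zmod_two_eq_of_zero_iff (h4.trans ?_)⟩ <;>
    clear h1 h2 h3 h4 hZ <;>
    generalize (X n : ZMod 2) = x at * <;>
    generalize (Y n : ZMod 2) = y at * <;>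
    generalize (X (n + 1) : ZMod 2) = x' at * <;>
    generalize (Y (n + 1) : ZMod 2) = y' at *
    · clear hKs; revert x y δ; decide +kernel
    · clear hKs; revert x y δ; decide +kernel
    · clear hKn; revert x' y' δ; decide +kernel
    · clear hKn; revert x' y' δ; decide +kernel

theorem natCast_XY_of_hankelDet {N : ℕ} {y x : ZMod 2} (h : ∀ δ, hankelDet δ N = y + δ * x) :
    (X N : ZMod 2) = x ∧ (Y N : ZMod 2) = y := by
  have h0 := h 0
  have h1 := h 1
  rw [hankelDet_eq] at h0 h1
  simp only [zero_mul, add_zero, one_mul] at h0 h1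
  rw [h0] at h1
  exact ⟨add_left_cancel h1, h0⟩

/-- Recurrences mod 2 for `X, Y, Z` in the case `d = 5`. -/
theorem F5_recurrences_XYZ :
    ∀ n : ℕ, 1 ≤ n →
      X (5 * n) ≡ X n [MOD 2] ∧
      Y (5 * n) ≡ Y n [MOD 2] ∧
      X (5 * n + 1) ≡ Z (n + 1) * Y n [MOD 2] ∧
      Y (5 * n + 1) ≡ Z (n + 1) * (X n + Y n) [MOD 2] ∧
      X (5 * n + 2) ≡ Z (n + 1) * (X n + Y n) [MOD 2] ∧
      Y (5 * n + 2) ≡ Z (n + 1) * X n [MOD 2] ∧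
      X (5 * n + 3) ≡ Z (n + 1) * (X (n + 1) + Y (n + 1)) [MOD 2] ∧
      Y (5 * n + 3) ≡ Z (n + 1) * X (n + 1) [MOD 2] ∧
      X (5 * n + 4) ≡ Z (n + 1) * Y (n + 1) [MOD 2] ∧
      Y (5 * n + 4) ≡ Z (n + 1) * (X (n + 1) + Y (n + 1)) [MOD 2] ∧
      Z (5 * n) ≡ Z n * (X n + X n * Y n + Y n) [MOD 2] ∧
      Z (5 * n + 1) ≡ Z (n + 1) * (X n + X n * Y n + Y n) [MOD 2] ∧
      Z (5 * n + 2) ≡ Z (n + 1) * (X n + X n * Y n + Y n) [MOD 2] ∧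
      Z (5 * n + 3) ≡ Z (n + 1) [MOD 2] ∧
      Z (5 * n + 4) ≡ Z (n + 1) * (X (n + 1) + X (n + 1) * Y (n + 1) + Y (n + 1)) [MOD 2] := by
  intro n hn
  obtain ⟨k, rfl⟩ : ∃ k, n = k + 1 := ⟨n - 1, by omega⟩
  have h0 (n : ℕ) := natCast_XY_of_hankelDet (hankelDet_five_mul n)
  have h1 (n : ℕ) := natCast_XY_of_hankelDet (N := 5 * n + 1) (x := Z (n + 1) * Y n)
    (y := Z (n + 1) * (X n + Y n)) fun δ => by rw [(hankelDet_five_mul_add n δ).1]; ring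
  have h2 (n : ℕ) := natCast_XY_of_hankelDet (N := 5 * n + 2) (x := Z (n + 1) * (X n + Y n))
    (y := Z (n + 1) * X n) fun δ => by rw [(hankelDet_five_mul_add n δ).2.1]; ring
  have h3 (n : ℕ) := natCast_XY_of_hankelDet (N := 5 * n + 3)
    (x := Z (n + 1) * (X (n + 1) + Y (n + 1))) (y := Z (n + 1) * X (n + 1))
    fun δ => by rw [(hankelDet_five_mul_add n δ).2.2.1]; ring
  have h4 (n : ℕ) := natCast_XY_of_hankelDet (N := 5 * n + 4) (x := Z (n + 1) * Y (n + 1))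
    (y := Z (n + 1) * (X (n + 1) + Y (n + 1)))
    fun δ => by rw [(hankelDet_five_mul_add n δ).2.2.2]; ring
  have hz := natCast_Z_succ (k + 1)
  simp only [← ZMod.natCast_eq_natCast_iff, Nat.cast_mul, Nat.cast_add]
  refine ⟨(h0 _).1, (h0 _).2, (h1 _).1, (h1 _).2, (h2 _).1, (h2 _).2, (h3 _).1, (h3 _).2,
    (h4 _).1, (h4 _).2, ?_, ?_, ?_, ?_, ?_⟩
  · rw [show 5 * (k + 1) = 5 * k + 4 + 1 by ring, natCast_Z_succ,
      show 5 * k + 4 + 1 = 5 * (k + 1) by ring, (h0 _).1, (h0 _).2, (h4 _).1, (h4 _).2]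
    generalize (X (k + 1) : ZMod 2) = x
    generalize (Y (k + 1) : ZMod 2) = y
    generalize (Z (k + 1) : ZMod 2) = z
    revert x y z
    decide
  · rw [natCast_Z_succ, (h0 _).1, (h0 _).2, (h1 _).1, (h1 _).2]
    generalize (X (k + 1) : ZMod 2) = x
    generalize (Y (k + 1) : ZMod 2) = y
    generalize (Z (k + 1 + 1) : ZMod 2) = z
    revert x y z
    decide
  · rw [natCast_Z_succ, (h1 _).1, (h1 _).2, (h2 _).1, (h2 _).2]
    generalize (X (k + 1) : ZMod 2) = x
    generalize (Y (k + 1) : ZMod 2) = y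
    generalize (Z (k + 1 + 1) : ZMod 2) = z
    revert x y z
    decide
  · rw [natCast_Z_succ, (h2 _).1, (h2 _).2, (h3 _).1, (h3 _).2, hz]
    generalize (X (k + 1) : ZMod 2) = x
    generalize (Y (k + 1) : ZMod 2) = y
    generalize (X (k + 1 + 1) : ZMod 2) = x'
    generalize (Y (k + 1 + 1) : ZMod 2) = y'
    revert x y x' y'
    decide
  · rw [natCast_Z_succ, (h3 _).1, (h3 _).2, (h4 _).1, (h4 _).2]
    generalize (X (k + 1 + 1) : ZMod 2) = x
    generalize (Y (k + 1 + 1) : ZMod 2) = y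
    generalize (Z (k + 1 + 1) : ZMod 2) = z
    revert x y z
    decide
end

section
/- For the set J associated with d = 5 and v = (1,−1,−1,−1,1), with T_n = X_n + X_nY_n + Y_n, the following congruences hold modulo 2 for every n ≥ 1: Z_{5n} ≡ Z_nT_n; T_{5n} ≡ T_n; Z_{5n+1} ≡ Z_{n+1}T_n; T_{5n+1} ≡ Z_{n+1}T_n; Z_{5n+2} ≡ Z_{n+1}T_n; T_{5n+2} ≡ Z_{n+1}T_n; Z_{5n+3} ≡ Z_{n+1}; T_{5n+3} ≡ Z_{n+1}T_{n+1}; Z_{5n+4} ≡ Z_{n+1}T_{n+1}; T_{5n+4} ≡ Z_{n+1}T_{n+1}. -/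
noncomputable def T (n : ℕ) : ℕ := X n + X n * Y n + Y n

open Finset

/-! ### The indicator of `J5` modulo `5` -/

open Classical in
/-- The indicator function of `J5` with values in `ZMod 2`. -/
noncomputable def indJ (t : ℕ) : ZMod 2 := if t ∈ J5 then 1 else 0

lemma mem_J5_iff (t : ℕ) :
    t ∈ J5 ↔ ∃ n k : ℕ, t + 1 = (5 * n + 1) * 5 ^ k ∨ t + 1 = (5 * n + 4) * 5 ^ k := by
  simp only [J5, Set.mem_union, Set.mem_ofPred_eq, exists_or]

lemma mem_J5_of_mod {t : ℕ} (h : t % 5 = 0 ∨ t % 5 = 3) : t ∈ J5 := by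
  rw [mem_J5_iff]
  refine ⟨t / 5, 0, ?_⟩
  omega

lemma notMem_J5_of_mod {t : ℕ} (h : t % 5 = 1 ∨ t % 5 = 2) : t ∉ J5 := by
  rw [mem_J5_iff]
  rintro ⟨n, _ | k, hk⟩
  · omega
  · simp only [pow_succ, ← mul_assoc] at hk
    omega

lemma five_mul_add_four_mem_J5 (t : ℕ) : 5 * t + 4 ∈ J5 ↔ t ∈ J5 := by
  simp only [mem_J5_iff]
  constructor
  · rintro ⟨n, _ | k, hk⟩
    · omega
    · refine ⟨n, k, ?_⟩
      simp only [pow_succ, ← mul_assoc] at hk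
      omega
  · rintro ⟨n, k, hk⟩
    refine ⟨n, k + 1, ?_⟩
    simp only [pow_succ, ← mul_assoc]
    omega

lemma indJ_five_mul_add_four (t : ℕ) : indJ (5 * t + 4) = indJ t := by
  classical
  exact if_congr (five_mul_add_four_mem_J5 t) rfl rfl

lemma indJ_of_mod {t : ℕ} (h : t % 5 = 0 ∨ t % 5 = 3) : indJ t = 1 :=
  if_pos (mem_J5_of_mod h)

lemma indJ_of_mod' {t : ℕ} (h : t % 5 = 1 ∨ t % 5 = 2) : indJ t = 0 :=
  if_neg (notMem_J5_of_mod h)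

/-! ### Systems of Hankel equations -/

/-- `w` is supported on `{0,…,b−1}`, the first `a` entries of the product of the Hankel matrix
`(indJ (i + j))` with `w` equal `τ`, and the entries of `w` sum to `σ`. -/
def IsHankelSol (a b : ℕ) (τ σ : ZMod 2) (w : ℕ → ZMod 2) : Prop :=
  (∀ j, b ≤ j → w j = 0) ∧ (∀ i < a, ∑ j ∈ range b, indJ (i + j) * w j = τ) ∧
    ∑ j ∈ range b, w j = σ

/-- The `a × b` Hankel matrix of `indJ`, with a row of ones added, has trivial kernel. -/
def HankelInj (a b : ℕ) : Prop :=
  ∀ w, IsHankelSol a b 0 0 w → w = 0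

lemma sum_range_eq_of_support {w : ℕ → ZMod 2} {b L : ℕ} (hbL : b ≤ L)
    (hw : ∀ j, b ≤ j → w j = 0) (f : ℕ → ZMod 2) :
    ∑ j ∈ range b, f j * w j = ∑ j ∈ range L, f j * w j := by
  refine sum_subset (range_subset_range.2 hbL) fun j _ hj => ?_
  rw [hw j (by simpa using hj), mul_zero]

lemma isHankelSol_iff {a b L : ℕ} (hbL : b ≤ L) {τ σ : ZMod 2} {w : ℕ → ZMod 2} :
    IsHankelSol a b τ σ w ↔ (∀ j, b ≤ j → w j = 0) ∧
      (∀ i < a, ∑ j ∈ range L, indJ (i + j) * w j = τ) ∧ ∑ j ∈ range L, w j = σ := by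
  refine and_congr_right fun hw => ?_
  have h1 := sum_range_eq_of_support hbL hw fun _ => 1
  simp only [one_mul] at h1
  simp only [h1, fun i => sum_range_eq_of_support hbL hw fun j => indJ (i + j)]

lemma IsHankelSol.mono {a a' b b' : ℕ} {τ σ : ZMod 2} {w : ℕ → ZMod 2}
    (h : IsHankelSol a b τ σ w) (ha : a' ≤ a) (hb : b ≤ b') : IsHankelSol a' b' τ σ w := by
  obtain ⟨h1, h2, h3⟩ := (isHankelSol_iff hb).1 h
  exact ⟨fun j hj => h1 j (hb.trans hj), fun i hi => h2 i (hi.trans_le ha), h3⟩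

lemma HankelInj.mono {a a' b b' : ℕ} (h : HankelInj a b) (ha : a ≤ a') (hb : b' ≤ b) :
    HankelInj a' b' :=
  fun w hw => h w (hw.mono ha hb)

/-- Symmetry of the Hankel form, evaluated on two solutions. -/
lemma IsHankelSol.mul_eq_mul {a b a' b' : ℕ} {τ σ τ' σ' : ZMod 2} {w w' : ℕ → ZMod 2}
    (h : IsHankelSol a b τ σ w) (h' : IsHankelSol a' b' τ' σ' w') (hb : b' ≤ a) (hb' : b ≤ a') :
    τ * σ' = τ' * σ := by
  rw [← h.2.2, ← h'.2.2, mul_sum, mul_sum]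
  calc ∑ i ∈ range b', τ * w' i
      = ∑ i ∈ range b', ∑ j ∈ range b, indJ (i + j) * w j * w' i := by
        refine sum_congr rfl fun i hi => ?_
        rw [← sum_mul, h.2.1 i ((mem_range.1 hi).trans_le hb)]
    _ = ∑ j ∈ range b, ∑ i ∈ range b', indJ (i + j) * w j * w' i := sum_comm
    _ = ∑ j ∈ range b, τ' * w j := by
        refine sum_congr rfl fun j hj => ?_
        rw [← h'.2.1 j ((mem_range.1 hj).trans_le hb'), sum_mul]
        exact sum_congr rfl fun i _ => by rw [add_comm i j]; ring

/-! ### Determinants modulo `2` -/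

/-- Extension of a finite vector by zero. -/
def extendZero {N : ℕ} (v : Fin N → ZMod 2) (j : ℕ) : ZMod 2 :=
  if h : j < N then v ⟨j, h⟩ else 0

@[simp] lemma extendZero_val {N : ℕ} (v : Fin N → ZMod 2) (j : Fin N) :
    extendZero v j = v j := by
  simp [extendZero]

lemma extendZero_eq_zero_iff {N : ℕ} {v : Fin N → ZMod 2} : extendZero v = 0 ↔ v = 0 := by
  refine ⟨fun h => funext fun j => by simpa using congrFun h j, ?_⟩
  rintro rfl
  funext j
  simp [extendZero]

/-- The `N × N` Hankel matrix of `indJ`. -/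
noncomputable def hankel (N : ℕ) : Matrix (Fin N) (Fin N) (ZMod 2) :=
  Matrix.of fun i j => indJ (i + j)

lemma hankel_transpose (N : ℕ) : (hankel N).transpose = hankel N := by
  ext i j
  simp [hankel, add_comm]

lemma sum_range_extendZero {N : ℕ} (v : Fin N → ZMod 2) :
    ∑ j ∈ range N, extendZero v j = ∑ j, v j := by
  simp [← Fin.sum_univ_eq_sum_range]

lemma hankel_mulVec_apply {N : ℕ} (v : Fin N → ZMod 2) (i : Fin N) :
    (hankel N).mulVec v i = ∑ j ∈ range N, indJ (i + j) * extendZero v j := by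
  rw [← Fin.sum_univ_eq_sum_range fun j => indJ (i + j) * extendZero v j]
  simp [hankel, Matrix.mulVec, dotProduct]

lemma isHankelSol_extendZero_iff {a N : ℕ} (ha : a ≤ N) {τ σ : ZMod 2} {v : Fin N → ZMod 2} :
    IsHankelSol a N τ σ (extendZero v) ↔
      (∀ i : Fin N, (i : ℕ) < a → (hankel N).mulVec v i = τ) ∧ ∑ j, v j = σ := by
  have h0 : ∀ j, N ≤ j → extendZero v j = 0 := fun j hj => by simp [extendZero, hj.not_gt]
  simp only [IsHankelSol, sum_range_extendZero, hankel_mulVec_apply]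
  exact ⟨fun h => ⟨fun i hi => h.2.1 i hi, h.2.2⟩,
    fun h => ⟨h0, fun i hi => h.1 ⟨i, hi.trans_le ha⟩ hi, h.2⟩⟩

lemma extendZero_restrict {N : ℕ} {w : ℕ → ZMod 2} (h : ∀ j, N ≤ j → w j = 0) :
    extendZero (fun j : Fin N => w j) = w := by
  funext j
  by_cases hj : j < N
  · simp [extendZero, hj]
  · simp [extendZero, hj, h j (not_lt.1 hj)]

lemma hankelInj_iff {a N : ℕ} (ha : a ≤ N) :
    HankelInj a N ↔ ∀ v : Fin N → ZMod 2,
      (∀ i : Fin N, (i : ℕ) < a → (hankel N).mulVec v i = 0) → ∑ j, v j = 0 → v = 0 := by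
  constructor
  · intro h v h1 h2
    exact extendZero_eq_zero_iff.1 (h _ ((isHankelSol_extendZero_iff ha).2 ⟨h1, h2⟩))
  · intro h w hw
    have he := extendZero_restrict hw.1
    rw [← he] at hw ⊢
    have := (isHankelSol_extendZero_iff ha).1 hw
    exact extendZero_eq_zero_iff.2 (h _ this.1 this.2)

/-- Modulo `2`, a number of permutations with prescribed positions is a determinant. -/
lemma natCast_card_perm_eq_det {N : ℕ} (p : Fin N → Fin N → Prop) [∀ i j, Decidable (p i j)] :
    ((Nat.card {σ : Equiv.Perm (Fin N) // ∀ i, p i (σ i)} : ℕ) : ZMod 2) =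
      (Matrix.of fun i j => if p i j then (1 : ZMod 2) else 0).det := by
  rw [← Matrix.det_transpose, Matrix.det_apply, Nat.card_eq_fintype_card, Fintype.card_subtype,
    Finset.card_filter, Nat.cast_sum]
  refine sum_congr rfl fun σ _ => ?_
  have hs : ∀ (u : ℤˣ) (x : ZMod 2), u • x = x := by
    intro u x
    rcases Int.units_eq_one_or u with rfl | rfl
    · simp
    · simp [Units.smul_def, ZMod.neg_eq_self_mod_two]
  simp only [hs, Matrix.transpose_apply, Matrix.of_apply, Finset.prod_ite_zero]
  simp

lemma permCount_cast (N l : ℕ) :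
    (permCount J5 N l : ZMod 2) =
      (Matrix.of fun i j : Fin N => if (i : ℕ) = l then 1 else hankel N i j).det := by
  classical
  rw [permCount, natCast_card_perm_eq_det fun i j : Fin N => (i : ℕ) ≠ l → (i : ℕ) + j ∈ J5]
  congr 1
  ext i j
  by_cases h : (i : ℕ) = l <;> simp [h, hankel, indJ]

lemma permCount_cast_self (N : ℕ) : (permCount J5 N N : ZMod 2) = (hankel N).det := by
  rw [permCount_cast]
  congr 1
  ext i j
  simp [i.2.ne]

lemma permCount_cast_fin {N : ℕ} (l : Fin N) :
    (permCount J5 N l : ZMod 2) = ((hankel N).updateRow l 1).det := by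
  rw [permCount_cast]
  congr 1
  ext i j
  simp [Matrix.updateRow_apply, Fin.ext_iff]

lemma updateRow_one_mulVec_eq_zero_iff {N : ℕ} (l : Fin N) (v : Fin N → ZMod 2) :
    ((hankel N).updateRow l 1).mulVec v = 0 ↔
      (∀ i, i ≠ l → (hankel N).mulVec v i = 0) ∧ ∑ j, v j = 0 := by
  have key : ∀ i, ((hankel N).updateRow l 1).mulVec v i =
      if i = l then ∑ j, v j else (hankel N).mulVec v i := by
    intro i
    split_ifs with h <;> simp [Matrix.mulVec, dotProduct, Matrix.updateRow_apply, h]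
  constructor
  · intro h
    refine ⟨fun i hi => ?_, ?_⟩
    · simpa [key, hi] using congrFun h i
    · simpa [key] using congrFun h l
  · rintro ⟨h1, h2⟩
    funext i
    rw [key]
    split_ifs with h
    · exact h2
    · exact h1 i h

lemma det_updateRow_last_ne_zero_iff (n : ℕ) :
    ((hankel (n + 1)).updateRow (Fin.last n) 1).det ≠ 0 ↔ HankelInj n (n + 1) := by
  rw [hankelInj_iff n.le_succ, Ne, ← Matrix.exists_mulVec_eq_zero_iff]
  simp only [updateRow_one_mulVec_eq_zero_iff]
  push Not
  refine forall_congr' fun v => ?_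
  have : ∀ i : Fin (n + 1), i ≠ Fin.last n ↔ (i : ℕ) < n := fun i => by
    rw [Ne, Fin.ext_iff, Fin.val_last]
    omega
  simp only [this]
  tauto

lemma Z_cast_ne_zero_iff (n : ℕ) : (Z (n + 1) : ZMod 2) ≠ 0 ↔ HankelInj n (n + 1) := by
  rw [← det_updateRow_last_ne_zero_iff, ← permCount_cast_fin]
  simp [Z]

lemma T_cast_ne_zero_iff (N : ℕ) : (T N : ZMod 2) ≠ 0 ↔ HankelInj N N := by
  have hT : (T N : ZMod 2) = 0 ↔ (X N : ZMod 2) = 0 ∧ (Y N : ZMod 2) = 0 := by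
    simp only [T, Nat.cast_add, Nat.cast_mul]
    generalize (X N : ZMod 2) = x
    generalize (Y N : ZMod 2) = y
    revert x y
    decide
  have hX : (X N : ZMod 2) = ∑ l, (hankel N).cramer 1 l := by
    rw [X, ← Fin.sum_univ_eq_sum_range, Nat.cast_sum]
    refine sum_congr rfl fun l _ => ?_
    rw [permCount_cast_fin, ← Matrix.cramer_transpose_apply, hankel_transpose]
  rw [hankelInj_iff le_rfl, Ne, hT, Y, permCount_cast_self, hX]
  simp only [Fin.is_lt, forall_true_left]
  constructor
  · intro h v hv hs
    by_contra hv0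
    refine h ⟨sum_eq_zero fun l _ => ?_, ?_⟩
    · rw [← hankel_transpose, Matrix.cramer_transpose_apply]
      exact Matrix.exists_mulVec_eq_zero_iff.1
        ⟨v, hv0, (updateRow_one_mulVec_eq_zero_iff l v).2 ⟨fun i _ => hv i, hs⟩⟩
    · exact Matrix.exists_mulVec_eq_zero_iff.1 ⟨v, hv0, funext hv⟩
  · rintro h ⟨hx, hy⟩
    obtain ⟨w, hw0, hw⟩ := Matrix.exists_mulVec_eq_zero_iff.2 hy
    have hu : (hankel N).cramer 1 = 0 := by
      refine h _ (fun i => ?_) hx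
      rw [Matrix.mulVec_cramer, hy, zero_smul, Pi.zero_apply]
    refine hw0 (funext fun l => ?_)
    have hl : ((hankel N).updateRow l 1).det = 0 := by
      rw [← Matrix.cramer_transpose_apply, hankel_transpose, hu, Pi.zero_apply]
    obtain ⟨v, hv0, hv⟩ := Matrix.exists_mulVec_eq_zero_iff.2 hl
    obtain ⟨hv1, hv2⟩ := (updateRow_one_mulVec_eq_zero_iff l v).1 hv
    have hvl : (hankel N).mulVec v l ≠ 0 := fun h0 => hv0 (h v (fun i => by
      by_cases hi : i = l
      · rw [hi, h0]
      · exact hv1 i hi) hv2)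
    have hpair : w l * (hankel N).mulVec v l = 0 := by
      calc w l * (hankel N).mulVec v l = w ⬝ᵥ (hankel N).mulVec v := by
            rw [dotProduct, Finset.sum_eq_single l (fun i _ hi => by rw [hv1 i hi, mul_zero])
              (by simp)]
        _ = 0 := by
            rw [Matrix.dotProduct_mulVec, ← Matrix.mulVec_transpose, hankel_transpose, hw,
              zero_dotProduct]
    exact (mul_eq_zero.1 hpair).resolve_right hvl

lemma HankelInj.exists_isHankelSol {n : ℕ} (h : HankelInj n (n + 1)) (τ σ : ZMod 2) :
    ∃ w, IsHankelSol n (n + 1) τ σ w := by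
  have hdet := (det_updateRow_last_ne_zero_iff n).2 h
  set G := (hankel (n + 1)).updateRow (Fin.last n) 1 with hG
  let rhs : Fin (n + 1) → ZMod 2 := fun i => if i = Fin.last n then σ else τ
  have hsol : G.mulVec (G⁻¹.mulVec rhs) = rhs := by
    rw [Matrix.mulVec_mulVec, Matrix.mul_nonsing_inv _ (isUnit_iff_ne_zero.2 hdet),
      Matrix.one_mulVec]
  refine ⟨extendZero (G⁻¹.mulVec rhs), (isHankelSol_extendZero_iff n.le_succ).2 ⟨?_, ?_⟩⟩
  · intro i hi
    have hi' : i ≠ Fin.last n := fun h => by simp [h] at hi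
    have := congrFun hsol i
    simpa [hG, rhs, hi', Matrix.mulVec, dotProduct, Matrix.updateRow_apply] using this
  · have := congrFun hsol (Fin.last n)
    simpa [hG, rhs, Matrix.mulVec, dotProduct, Matrix.updateRow_apply] using this

/-! ### Splitting by residues modulo `5` -/

lemma sum_range_five_mul (f : ℕ → ZMod 2) (L : ℕ) :
    ∑ j ∈ range (5 * L), f j = ∑ c : Fin 5, ∑ q ∈ range L, f (5 * q + c) := by
  induction L with
  | zero => simp
  | succ L ih =>
    simp only [mul_add, mul_one, sum_range_succ, ih, sum_add_distrib, Fin.sum_univ_five]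
    simp
    ring

lemma sum_indJ_mul_eq (w : ℕ → ZMod 2) (p L : ℕ) (c d : Fin 5) :
    ∑ q ∈ range L, indJ (5 * p + (4 - c) + (5 * q + d)) * w (5 * q + d) =
      (if d = c then ∑ q ∈ range L, indJ (p + q) * w (5 * q + c) else 0) +
      if d = c - 1 ∨ d = c + 1 then ∑ q ∈ range L, w (5 * q + d) else 0 := by
  have hind : ∀ q, indJ (5 * p + (4 - c) + (5 * q + d)) =
      (if d = c then indJ (p + q) else 0) + if d = c - 1 ∨ d = c + 1 then 1 else 0 := by
    intro q
    by_cases hcd : d = c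
    · subst hcd
      have h1 : ¬ (d = d - 1 ∨ d = d + 1) := by revert d; decide
      have h2 : 5 * p + (4 - (d : ℕ)) + (5 * q + d) = 5 * (p + q) + 4 := by omega
      rw [if_pos rfl, if_neg h1, add_zero, h2, indJ_five_mul_add_four]
    · rw [if_neg hcd, zero_add]
      have hmod : (5 * p + (4 - (c : ℕ)) + (5 * q + d)) % 5 = (4 - (c : ℕ) + d) % 5 := by omega
      split_ifs with h
      · refine indJ_of_mod ?_
        rw [hmod]
        clear hmod
        revert c d
        decide
      · refine indJ_of_mod' ?_
        rw [hmod]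
        clear hmod
        revert c d
        decide
  simp only [hind, add_mul, sum_add_distrib, ite_mul, zero_mul, one_mul]
  congr 1
  · split_ifs with h
    · rw [h]
    · simp
  · split_ifs <;> simp

lemma sum_indJ_mul_five_mul (w : ℕ → ZMod 2) (p L : ℕ) (c : Fin 5) :
    ∑ j ∈ range (5 * L), indJ (5 * p + (4 - c) + j) * w j =
      ∑ q ∈ range L, indJ (p + q) * w (5 * q + c) +
        (∑ q ∈ range L, w (5 * q + (c - 1 : Fin 5)) +
          ∑ q ∈ range L, w (5 * q + (c + 1 : Fin 5))) := by
  rw [sum_range_five_mul]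
  simp only [sum_indJ_mul_eq, sum_add_distrib]
  rw [Finset.sum_ite_eq' univ c, if_pos (mem_univ c), ← Finset.sum_filter]
  congr 1
  have hf : (univ.filter fun d : Fin 5 => d = c - 1 ∨ d = c + 1) = {c - 1, c + 1} := by
    ext d
    simp
  rw [hf, Finset.sum_pair (by revert c; decide)]

/-- For `m ≤ 5`, the number of `j ∈ [5 * n, 5 * n + m)` congruent to `c` modulo `5`. -/
def carry (m : ℕ) (c : Fin 5) : ℕ := if (c : ℕ) < m then 1 else 0

/-- The finite system satisfied by the block sums of a kernel vector has no nonzero solution. -/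
lemma blockSums_eq_zero : ∀ m ∈ Icc 1 5, ∀ a ∈ Icc (m - 1) m, ∀ s : Fin 5 → ZMod 2,
    (∀ c d, carry m d ≤ carry a c.rev → carry m c ≤ carry a d.rev →
      (s (c - 1) + s (c + 1)) * s d = (s (d - 1) + s (d + 1)) * s c) →
    (∀ c, carry m c = 0 → carry a c.rev = 1 → s c = 0 ∧ s (c - 1) + s (c + 1) = 0) →
    ∑ c, s c = 0 → ∀ c, s c = 0 := by
  decide +kernel

lemma isHankelSol_block {n m a : ℕ} (hm : m ≤ 5) {w : ℕ → ZMod 2}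
    (hw : IsHankelSol (5 * n + a) (5 * n + m) 0 0 w) (c : Fin 5) :
    IsHankelSol (n + carry a c.rev) (n + carry m c)
      (∑ q ∈ range (n + 1), w (5 * q + (c - 1 : Fin 5)) +
        ∑ q ∈ range (n + 1), w (5 * q + (c + 1 : Fin 5)))
      (∑ q ∈ range (n + 1), w (5 * q + c)) fun q => w (5 * q + c) := by
  obtain ⟨h1, h2, -⟩ := (isHankelSol_iff (L := 5 * (n + 1)) (by omega)).1 hw
  have hc := c.2
  refine (isHankelSol_iff (L := n + 1) ?_).2 ⟨fun q hq => h1 _ ?_, fun p hp => ?_, rfl⟩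
  · rw [carry]
    split_ifs <;> omega
  · rw [carry] at hq
    split_ifs at hq <;> omega
  · have := h2 (5 * p + (4 - c)) (by
      rw [carry, Fin.val_rev] at hp
      split_ifs at hp <;> omega)
    rw [sum_indJ_mul_five_mul] at this
    exact CharTwo.add_eq_zero.1 this

lemma HankelInj.five_mul {n m a : ℕ} (hm : m ∈ Icc 1 5) (ha : a ∈ Icc (m - 1) m)
    (h : HankelInj (n + carry a 4) (n + 1)) : HankelInj (5 * n + a) (5 * n + m) := by
  intro w hw
  have hm5 : m ≤ 5 := (mem_Icc.1 hm).2
  rw [mem_Icc] at ha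
  have hblock := isHankelSol_block hm5 hw
  have hsum : ∑ c : Fin 5, ∑ q ∈ range (n + 1), w (5 * q + c) = 0 := by
    rw [← sum_range_five_mul]
    exact ((isHankelSol_iff (by omega)).1 hw).2.2
  have hcarry : ∀ m c, carry m c ≤ 1 := fun m c => by
    rw [carry]
    split_ifs <;> simp
  have hs := blockSums_eq_zero m hm a (mem_Icc.2 ha) (fun c => ∑ q ∈ range (n + 1), w (5 * q + c))
    (fun c d hcd hdc => (hblock c).mul_eq_mul (hblock d) (by omega) (by omega))
    (fun c hmc hac => by
      have h0 : carry a 4 = 0 := by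
        simp only [carry] at hmc ⊢
        (split_ifs at hmc ⊢ with h4 <;> simp at *); omega
      rw [h0, add_zero] at h
      have hbc := hblock c
      rw [hmc, hac] at hbc
      constructor
      · obtain ⟨u, hu⟩ := h.exists_isHankelSol 1 0
        simpa using (hbc.mul_eq_mul hu le_rfl le_rfl).symm
      · obtain ⟨u, hu⟩ := h.exists_isHankelSol 0 1
        simpa using hbc.mul_eq_mul hu le_rfl le_rfl) hsum
  funext j
  obtain ⟨c, hc⟩ : ∃ c : Fin 5, (c : ℕ) = j % 5 := ⟨⟨j % 5, Nat.mod_lt _ (by norm_num)⟩, rfl⟩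
  have hj := hblock c
  rw [hs, hs, hs, add_zero] at hj
  have hle : carry a 4 ≤ carry a c.rev := by
    simp only [carry, Fin.val_rev]
    (split_ifs with h4 h5 <;> simp at *); omega
  have h0 := congrFun (h.mono (Nat.add_le_add_left hle n)
    (Nat.add_le_add_left (hcarry m c) n) _ hj) (j / 5)
  simpa [hc, Nat.div_add_mod] using h0

lemma HankelInj.of_five_mul {n m a : ℕ} (hm : m ∈ Icc 1 5)
    (ha : a ∈ Icc (m - 1) m) (h : HankelInj (5 * n + a) (5 * n + m)) : HankelInj (n + carry a 4) (n + 1) := by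
  intro u hu
  obtain ⟨h1, h2, h3⟩ := hu
  rw [mem_Icc] at hm ha
  let w : ℕ → ZMod 2 := fun j => if j % 5 = 0 then u (j / 5) else 0
  have hw : ∀ (c : Fin 5) q, w (5 * q + c) = if c = 0 then u q else 0 := by
    intro c q
    have hc := c.2
    have hmod : (5 * q + (c : ℕ)) % 5 = c := by omega
    have hdiv : (5 * q + (c : ℕ)) / 5 = q := by omega
    simp only [w, hmod, hdiv, Fin.val_eq_zero_iff]
  have hsum : ∀ c : Fin 5, ∑ q ∈ range (n + 1), w (5 * q + c) = 0 := by
    intro c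
    simp only [hw]
    split_ifs
    · exact h3
    · exact sum_const_zero
  have hsupp : ∀ j, 5 * n + m ≤ j → w j = 0 := by
    intro j hj
    simp only [w]
    split_ifs
    · exact h1 _ (by omega)
    · rfl
  have hker : w = 0 := by
    refine h w ?_
    refine (isHankelSol_iff (L := 5 * (n + 1)) (by omega)).2 ⟨hsupp, fun i hi => ?_, ?_⟩
    · obtain ⟨c, hc⟩ : ∃ c : Fin 5, (c : ℕ) = 4 - i % 5 := ⟨⟨4 - i % 5, by omega⟩, rfl⟩
      have hi5 : i = 5 * (i / 5) + (4 - c) := by omega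
      rw [hi5, sum_indJ_mul_five_mul, hsum, hsum, add_zero, add_zero]
      simp only [hw]
      split_ifs with hc0
      · refine h2 _ ?_
        simp only [hc0, Fin.val_zero] at hc
        simp only [carry]
        split_ifs with h4 <;> simp at h4 <;> omega
      · simp
    · rw [sum_range_five_mul]
      exact sum_eq_zero fun c _ => hsum c
  funext q
  simpa [hw] using (hw 0 q).symm.trans (congrFun hker _)

lemma hankelInj_five_mul_iff {n m a : ℕ} (hm : m ∈ Icc 1 5) (ha : a ∈ Icc (m - 1) m) :
    HankelInj (5 * n + a) (5 * n + m) ↔ HankelInj (n + carry a 4) (n + 1) :=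
  ⟨HankelInj.of_five_mul hm ha, HankelInj.five_mul hm ha⟩

/-! ### Parities of `Z` and `T` -/

lemma modEq_two_of_ne_zero_iff {a b : ℕ} (h : (a : ZMod 2) ≠ 0 ↔ (b : ZMod 2) ≠ 0) :
    a ≡ b [MOD 2] := by
  rw [← ZMod.natCast_eq_natCast_iff]
  generalize (a : ZMod 2) = x at *
  generalize (b : ZMod 2) = y at *
  revert x y
  decide

lemma Z_five_mul_add (n : ℕ) {m : ℕ} (hm : m ∈ Icc 1 5) :
    (Z (5 * n + m) : ZMod 2) ≠ 0 ↔ HankelInj n (n + 1) := by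
  rw [mem_Icc] at hm
  obtain ⟨k, rfl⟩ : ∃ k, m = k + 1 := ⟨m - 1, by omega⟩
  have h4 : carry k 4 = 0 := if_neg (by simp; omega)
  rw [← add_assoc, Z_cast_ne_zero_iff, add_assoc, hankelInj_five_mul_iff (mem_Icc.2 hm) (by simp),
    h4, add_zero]

lemma T_five_mul_add (n : ℕ) {m : ℕ} (hm : m ∈ Icc 1 4) :
    (T (5 * n + m) : ZMod 2) ≠ 0 ↔ HankelInj n (n + 1) := by
  rw [mem_Icc] at hm
  have h4 : carry m 4 = 0 := if_neg (by simp; omega)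
  rw [T_cast_ne_zero_iff, hankelInj_five_mul_iff (by simp; omega) (by simp), h4, add_zero]

lemma T_five_mul_succ (n : ℕ) :
    (T (5 * (n + 1)) : ZMod 2) ≠ 0 ↔ HankelInj (n + 1) (n + 1) := by
  rw [T_cast_ne_zero_iff, mul_add, mul_one, hankelInj_five_mul_iff (by simp) (by simp)]
  simp [carry]

lemma Z_mul_T_cast_ne_zero_iff (n : ℕ) :
    ((Z (n + 1) * T n : ℕ) : ZMod 2) ≠ 0 ↔ HankelInj n (n + 1) := by
  rw [Nat.cast_mul, mul_ne_zero_iff, Z_cast_ne_zero_iff, T_cast_ne_zero_iff]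
  exact and_iff_left_of_imp fun h => h.mono le_rfl n.le_succ

lemma Z_mul_T_succ_cast_ne_zero_iff (n : ℕ) :
    ((Z (n + 1) * T (n + 1) : ℕ) : ZMod 2) ≠ 0 ↔ HankelInj n (n + 1) := by
  rw [Nat.cast_mul, mul_ne_zero_iff, Z_cast_ne_zero_iff, T_cast_ne_zero_iff]
  exact and_iff_left_of_imp fun h => h.mono n.le_succ le_rfl

/-- Simplified recurrences mod 2 for `Z, T` (case `d = 5`). -/
theorem F5_recurrences_ZT :
    ∀ n : ℕ, 1 ≤ n →
      Z (5 * n) ≡ Z n * T n [MOD 2] ∧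
      T (5 * n) ≡ T n [MOD 2] ∧
      Z (5 * n + 1) ≡ Z (n + 1) * T n [MOD 2] ∧
      T (5 * n + 1) ≡ Z (n + 1) * T n [MOD 2] ∧
      Z (5 * n + 2) ≡ Z (n + 1) * T n [MOD 2] ∧
      T (5 * n + 2) ≡ Z (n + 1) * T n [MOD 2] ∧
      Z (5 * n + 3) ≡ Z (n + 1) [MOD 2] ∧
      T (5 * n + 3) ≡ Z (n + 1) * T (n + 1) [MOD 2] ∧
      Z (5 * n + 4) ≡ Z (n + 1) * T (n + 1) [MOD 2] ∧
      T (5 * n + 4) ≡ Z (n + 1) * T (n + 1) [MOD 2] := by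
  intro n hn
  refine ⟨?_, ?_, ?_, ?_, ?_, ?_, ?_, ?_, ?_, ?_⟩ <;> apply modEq_two_of_ne_zero_iff
  · obtain ⟨k, rfl⟩ : ∃ k, n = k + 1 := ⟨n - 1, by omega⟩
    rw [Z_mul_T_succ_cast_ne_zero_iff, mul_add, Z_five_mul_add k (by decide)]
  · obtain ⟨k, rfl⟩ : ∃ k, n = k + 1 := ⟨n - 1, by omega⟩
    rw [T_five_mul_succ, T_cast_ne_zero_iff]
  · rw [Z_five_mul_add n (by decide), Z_mul_T_cast_ne_zero_iff]
  · rw [T_five_mul_add n (by decide), Z_mul_T_cast_ne_zero_iff]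
  · rw [Z_five_mul_add n (by decide), Z_mul_T_cast_ne_zero_iff]
  · rw [T_five_mul_add n (by decide), Z_mul_T_cast_ne_zero_iff]
  · rw [Z_five_mul_add n (by decide), Z_cast_ne_zero_iff]
  · rw [T_five_mul_add n (by decide), Z_mul_T_succ_cast_ne_zero_iff]
  · rw [Z_five_mul_add n (by decide), Z_mul_T_succ_cast_ne_zero_iff]
  · rw [T_five_mul_add n (by decide), Z_mul_T_succ_cast_ne_zero_iff]
end
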